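/- arXiv:1501.03602 — 2 statements merged into one kernel-verified Lean document; each statement's English description precedes it below -/
import Mathlib

section
/- Let w, v, t be words over an alphabet A with v nonempty, such that |t| ≤ |w| and w·v is a prefix of t·v^i for some integer i ≥ 1. Then w = t·p_v^n for some n ≥ 0, where p_v is the primitive root of v. -/
/-- `r` is the primitive root of `w`: the shortest word whose power `w` is. -/
def IsPrimitiveRootOf {A : Type*} (r w : FreeMonoid A) : Prop :=
  (∃ k : ℕ, 1 ≤ k ∧ w = r ^ k) ∧
    ∀ r' : FreeMonoid A, (∃ k : ℕ, 1 ≤ k ∧ w = r' ^ k) → r.length ≤ r'.length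

theorem FreeMonoid.exists_eq_mul_of_mul_eq_mul {A : Type*} {a b c d : FreeMonoid A}
    (h : a * b = c * d) (hl : a.length ≤ c.length) : ∃ z, c = a * z ∧ b = z * d := by
  rcases List.append_eq_append_iff.mp (show a.toList ++ b.toList = c.toList ++ d.toList from h) with
    ⟨z, h₁, h₂⟩ | ⟨z, h₁, h₂⟩
  · exact ⟨FreeMonoid.ofList z, h₁, h₂⟩
  · have hz : z = [] := by
      have h₃ := congrArg List.length h₁
      rw [List.length_append] at h₃
      change a.length = c.length + z.length at h₃
      exact List.length_eq_zero_iff.mp (by omega)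
    subst hz
    refine ⟨1, ?_, ?_⟩
    · rw [mul_one]
      simpa using h₁.symm
    · rw [one_mul]
      simpa using h₂.symm

theorem FreeMonoid.eq_of_mul_eq_mul_of_length_eq {A : Type*} {a b c d : FreeMonoid A}
    (h : a * b = c * d) (hl : a.length = c.length) : a = c := by
  obtain ⟨z, hz, -⟩ := exists_eq_mul_of_mul_eq_mul h hl.le
  have hz₁ : z = 1 := by
    have := congrArg FreeMonoid.length hz
    rw [FreeMonoid.length_mul] at this
    exact FreeMonoid.length_eq_zero.mp (by omega)
  rw [hz, hz₁, mul_one]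

/-- A word `u` such that `u * p` is a prefix of a power of `p` commutes with `p`. -/
theorem FreeMonoid.commute_of_mul_prefix_pow {A : Type*} {u p s : FreeMonoid A} {m : ℕ}
    (h : p ^ m = u * p * s) : Commute u p := by
  have hcomm : (u * p) * (s * p) = (p * u) * (p * s) := by
    calc (u * p) * (s * p) = u * p * s * p := by simp only [mul_assoc]
      _ = p * (u * p * s) := by rw [← h, ← pow_succ, ← pow_succ']
      _ = (p * u) * (p * s) := by simp only [mul_assoc]
  exact eq_of_mul_eq_mul_of_length_eq hcomm
    (by rw [FreeMonoid.length_mul, FreeMonoid.length_mul, add_comm])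

/-- Commuting words are powers of a common word. -/
theorem FreeMonoid.exists_pow_of_commute {A : Type*} (x y : FreeMonoid A) (h : Commute x y) :
    ∃ (r : FreeMonoid A) (a b : ℕ), x = r ^ a ∧ y = r ^ b := by
  induction hn : x.length + y.length using Nat.strong_induction_on generalizing x y with
  | _ n ih =>
    wlog hxy : x.length ≤ y.length generalizing x y
    · obtain ⟨r, a, b, hy, hx⟩ := this y x h.symm (by omega) (by omega)
      exact ⟨r, b, a, hx, hy⟩
    by_cases hx : x = 1
    · exact ⟨y, 0, 1, by rw [hx, pow_zero], (pow_one y).symm⟩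
    obtain ⟨z, rfl, hz⟩ := exists_eq_mul_of_mul_eq_mul h.eq hxy
    have hpos : x.length ≠ 0 := fun h₀ => hx (FreeMonoid.length_eq_zero.mp h₀)
    rw [FreeMonoid.length_mul] at hn
    obtain ⟨r, a, b, ha, hb⟩ := ih _ (by omega) x z hz rfl
    exact ⟨r, a, a + b, ha, by rw [pow_add, ← ha, ← hb]⟩

/-- A word commuting with a primitive root is a power of it. -/
theorem IsPrimitiveRootOf.exists_eq_pow_of_commute {A : Type*} {p v u : FreeMonoid A}
    (hp : IsPrimitiveRootOf p v) (hv : v ≠ 1) (h : Commute u p) : ∃ n : ℕ, u = p ^ n := by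
  obtain ⟨⟨k, hk, hvk⟩, hmin⟩ := hp
  obtain ⟨r, b, a, hu, hpa⟩ := FreeMonoid.exists_pow_of_commute u p h
  have ha : a ≠ 0 := by
    rintro rfl
    exact hv (by rw [hvk, hpa, pow_zero, one_pow])
  have hle : p.length ≤ r.length :=
    hmin r ⟨a * k, Nat.mul_pos (Nat.pos_of_ne_zero ha) hk, by rw [pow_mul, ← hpa, hvk]⟩
  obtain ⟨c, rfl⟩ := Nat.exists_eq_succ_of_ne_zero ha
  have hc : r ^ c = 1 := by
    rw [hpa, pow_succ, FreeMonoid.length_mul] at hle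
    exact FreeMonoid.length_eq_zero.mp (by omega)
  exact ⟨b, by rw [hu, hpa, pow_succ, hc, one_mul]⟩

/-- If `v` is nonempty, `|t| ≤ |w|` and `wv` is a prefix of `t v^i` for some `i ≥ 1`,
then `w ∈ t p_v^*` where `p_v` is the primitive root of `v`. -/
theorem stmt12 {A : Type*} (w v t p : FreeMonoid A) (hv : v ≠ 1)
    (hlen : t.length ≤ w.length)
    (hpref : ∃ i : ℕ, 1 ≤ i ∧ ∃ s, t * v ^ i = w * v * s)
    (hp : IsPrimitiveRootOf p v) :
    ∃ n : ℕ, w = t * p ^ n := by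
  obtain ⟨i, -, s, hs⟩ := hpref
  rw [mul_assoc] at hs
  obtain ⟨u, rfl, hu⟩ := FreeMonoid.exists_eq_mul_of_mul_eq_mul hs hlen
  obtain ⟨k, hk, hvk⟩ := hp.1
  have hvp : v = p * p ^ (k - 1) := by rw [hvk, ← pow_succ', Nat.sub_add_cancel hk]
  have hprefix : p ^ (k * i) = u * p * (p ^ (k - 1) * s) := by
    rw [pow_mul, ← hvk, hu]
    nth_rewrite 1 [hvp]
    simp only [mul_assoc]
  obtain ⟨n, hn⟩ :=
    hp.exists_eq_pow_of_commute hv (FreeMonoid.commute_of_mul_prefix_pow hprefix)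
  exact ⟨n, by rw [hn]⟩
end

section
/- Let u, v, α, β be words over an alphabet A such that |u| ≥ |v|, both αu and βu are prefixes of v^i for some integer i ≥ 1, and |α| ≤ |β|. Then α is a suffix of β, and the word δ defined by β = δα commutes with v, i.e., δv = vδ. -/
namespace FreeMonoid

variable {A : Type*}

theorem exists_eq_mul_of_mul_eq_mul_right {a b c d : FreeMonoid A} (h : a * b = c * d)
    (hl : b.length ≤ d.length) : ∃ e, d = e * b := by
  have h' : toList a ++ toList b = toList c ++ toList d := congrArg toList h
  obtain ⟨e, he⟩ := List.suffix_of_suffix_length_le ⟨toList a, h'⟩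
    (List.suffix_append (toList c) (toList d)) hl
  exact ⟨ofList e, he.symm⟩

theorem eq_of_mul_eq_mul_of_length_eq_s14 {a b c d : FreeMonoid A} (h : a * b = c * d)
    (hl : a.length = c.length) : a = c :=
  List.append_inj_left (show toList a ++ toList b = toList c ++ toList d from
    congrArg toList h) hl

/-- Every word splits after any given number of letters not exceeding its length. -/
theorem exists_eq_mul_length_eq {u : FreeMonoid A} {n : ℕ} (h : n ≤ u.length) :
    ∃ w t, u = w * t ∧ w.length = n :=
  ⟨ofList ((toList u).take n), ofList ((toList u).drop n),
    (List.take_append_drop n (toList u)).symm, List.length_take_of_le h⟩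

/-- A power of `v` is invariant under a shift by `v.length` letters. -/
theorem semiconjBy_of_pow_eq_mul {v w x t : FreeMonoid A} {i : ℕ}
    (h : v ^ i = x * w * t) (hw : w.length = v.length) : SemiconjBy x w v := by
  refine eq_of_mul_eq_mul_of_length_eq_s14 (b := t * v) (d := w * t) ?_ ?_
  · calc x * w * (t * v) = v ^ i * v := by simp only [h, mul_assoc]
      _ = v * v ^ i := pow_mul_comm' v i
      _ = v * x * (w * t) := by simp only [h, mul_assoc]
  · simp only [length_mul, hw, add_comm]

/-- A prefix `x` of `v ^ i` that conjugates `w` into `v` is a suffix of `w ^ i`. -/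
theorem pow_eq_mul_of_semiconjBy {v w x s : FreeMonoid A} {i : ℕ}
    (h : v ^ i = x * s) (hx : SemiconjBy x w v) : w ^ i = s * x := by
  apply mul_left_cancel (a := x)
  rw [(hx.pow_right i).eq, h, mul_assoc]

end FreeMonoid

/-- If `|u| ≥ |v|`, `αu` and `βu` are prefixes of `v^i` for some `i ≥ 1`, and
`|α| ≤ |β|`, then `α` is a suffix of `β` and `βα⁻¹` commutes with `v`. -/
theorem stmt14 {A : Type*} (u v α β : FreeMonoid A) (i : ℕ) (hi : 1 ≤ i)
    (hlen : v.length ≤ u.length)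
    (hα : ∃ s, v ^ i = α * u * s) (hβ : ∃ s, v ^ i = β * u * s)
    (hαβ : α.length ≤ β.length) :
    ∃ δ : FreeMonoid A, β = δ * α ∧ δ * v = v * δ := by
  obtain ⟨s, hs⟩ := hα
  obtain ⟨t, ht⟩ := hβ
  obtain ⟨w, u', rfl, hw⟩ := FreeMonoid.exists_eq_mul_length_eq hlen
  have hα : SemiconjBy α w v :=
    FreeMonoid.semiconjBy_of_pow_eq_mul (t := u' * s) (by simpa only [mul_assoc] using hs) hw
  have hβ : SemiconjBy β w v :=
    FreeMonoid.semiconjBy_of_pow_eq_mul (t := u' * t) (by simpa only [mul_assoc] using ht) hw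
  have hαw := FreeMonoid.pow_eq_mul_of_semiconjBy (hs.trans (mul_assoc _ _ _)) hα
  have hβw := FreeMonoid.pow_eq_mul_of_semiconjBy (ht.trans (mul_assoc _ _ _)) hβ
  obtain ⟨δ, rfl⟩ :=
    FreeMonoid.exists_eq_mul_of_mul_eq_mul_right (hαw.symm.trans hβw) hαβ
  refine ⟨δ, rfl, mul_right_cancel (b := α) ?_⟩
  rw [mul_assoc, ← hα.eq, ← mul_assoc, hβ.eq, mul_assoc]
end
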